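/- Let m ≥ 2 and N = 2m. The number of permutations σ of ℤ/Nℤ for which σ ∘ f is not topologically mixing equals 2·(m!)²; equivalently, the proportion of such permutations among all N! permutations is the reciprocal of the binomial coefficient C(2m−1, m). -/

import Mathlib

open Set

noncomputable def fract01 (y : ℝ) : Set.Ico (0:ℝ) 1 :=
  ⟨Int.fract y, Int.fract_nonneg y, Int.fract_lt_one y⟩

/-- The map `f(x) = m x mod 1` on `[0,1)`. -/
noncomputable def mulMap (m : ℕ) (x : Set.Ico (0:ℝ) 1) : Set.Ico (0:ℝ) 1 :=
  fract01 (m * x.val)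

/-- The interval exchange map on `[0,1)` induced by a permutation `σ` of `ℤ/Nℤ`,
permuting the `N` subintervals `I_j = [j/N, (j+1)/N)`. -/
noncomputable def permMap (N : ℕ) (σ : Equiv.Perm (ZMod N)) (x : Set.Ico (0:ℝ) 1) :
    Set.Ico (0:ℝ) 1 :=
  fract01 (x.val +
    (((σ ((⌊(N : ℝ) * x.val⌋ : ℤ) : ZMod N)).val : ℝ) -
      (((⌊(N : ℝ) * x.val⌋ : ℤ) : ZMod N)).val) / N)

/-- Topological mixing of a self-map of a topological space. -/
def TopMixing {X : Type*} [TopologicalSpace X] (g : X → X) : Prop :=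
  ∀ U V : Set X, IsOpen U → IsOpen V → U.Nonempty → V.Nonempty →
    ∃ n₀ : ℕ, ∀ n ≥ n₀, (g^[n] '' U ∩ V).Nonempty

/-- The subinterval `I_j = [j/N, (j+1)/N)` of `[0,1)`. -/
def Isub (N : ℕ) (j : ZMod N) : Set (Set.Ico (0:ℝ) 1) :=
  {x | (j.val : ℝ) / N ≤ x.val ∧ x.val < ((j.val : ℝ) + 1) / N}

/-- `f̃(A) = {m·a + d : a ∈ A, 0 ≤ d ≤ m−1} ⊆ ℤ/Nℤ`. -/
def ftil (m N : ℕ) (A : Set (ZMod N)) : Set (ZMod N) :=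
  {b | ∃ a ∈ A, ∃ d : ℕ, d < m ∧ b = (m : ZMod N) * a + (d : ZMod N)}

/-- The index of the subinterval `I_j` containing `x`. -/
noncomputable def cell (N : ℕ) (x : Ico (0:ℝ) 1) : ZMod N := ((⌊(N : ℝ) * x.val⌋ : ℤ) : ZMod N)

theorem cell_val (N : ℕ) [NeZero N] (x : Ico (0:ℝ) 1) :
    ((cell N x).val : ℤ) = ⌊(N : ℝ) * x.val⌋ := by
  have hN : (0:ℝ) < N := by exact_mod_cast Nat.pos_of_ne_zero (NeZero.ne N)
  obtain ⟨x, h0, h1⟩ := x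
  rw [cell, ZMod.val_intCast]
  apply Int.emod_eq_of_lt
  · exact Int.floor_nonneg.2 (by positivity)
  · rw [Int.floor_lt]
    push_cast
    nlinarith

theorem permMap_val (N : ℕ) [NeZero N] (σ : Equiv.Perm (ZMod N)) (x : Ico (0:ℝ) 1) :
    (permMap N σ x).val = x.val + (((σ (cell N x)).val : ℝ) - (cell N x).val) / N := by
  have hN : (0:ℝ) < N := by exact_mod_cast Nat.pos_of_ne_zero (NeZero.ne N)
  have hj : ((cell N x).val : ℝ) = (⌊(N : ℝ) * x.val⌋ : ℤ) := by exact_mod_cast cell_val N x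
  have hl := Int.floor_le ((N : ℝ) * x.val)
  have hu := Int.lt_floor_add_one ((N : ℝ) * x.val)
  have hs : ((σ (cell N x)).val : ℝ) + 1 ≤ N := by exact_mod_cast ZMod.val_lt (σ (cell N x))
  have hs0 : (0 : ℝ) ≤ ((σ (cell N x)).val : ℝ) := by positivity
  change Int.fract (x.val + (((σ (cell N x)).val : ℝ) - (cell N x).val) / N) = _
  have key : x.val + (((σ (cell N x)).val : ℝ) - (cell N x).val) / N
      = (N * x.val + ((σ (cell N x)).val : ℝ) - (cell N x).val) / N := by
    field_simp
    ring
  rw [Int.fract_eq_self, key]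
  constructor
  · apply div_nonneg _ hN.le
    linarith
  · rw [div_lt_one hN]
    linarith

theorem mul_permMap_val (N : ℕ) [NeZero N] (σ : Equiv.Perm (ZMod N)) (x : Ico (0:ℝ) 1) :
    (N : ℝ) * (permMap N σ x).val
      = N * x.val + (((σ (cell N x)).val - (cell N x).val : ℤ) : ℝ) := by
  have hN : (N : ℝ) ≠ 0 := by exact_mod_cast NeZero.ne N
  rw [permMap_val]
  push_cast
  field_simp

theorem cell_permMap (N : ℕ) [NeZero N] (σ : Equiv.Perm (ZMod N)) (x : Ico (0:ℝ) 1) :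
    cell N (permMap N σ x) = σ (cell N x) := by
  conv_lhs => rw [cell]
  rw [mul_permMap_val, Int.floor_add_intCast, ← cell_val]
  simp

theorem permMap_permMap_inv (N : ℕ) [NeZero N] (σ : Equiv.Perm (ZMod N)) (x : Ico (0:ℝ) 1) :
    permMap N σ (permMap N σ⁻¹ x) = x := by
  apply Subtype.ext
  rw [permMap_val, cell_permMap, permMap_val]
  simp
  ring

theorem permMap_inv_permMap (N : ℕ) [NeZero N] (σ : Equiv.Perm (ZMod N)) (x : Ico (0:ℝ) 1) :
    permMap N σ⁻¹ (permMap N σ x) = x := by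
  simpa using permMap_permMap_inv N σ⁻¹ x

/-- `⌊c k x⌋` determines `⌊c x⌋`. -/
theorem floor_eq_of_floor_mul_eq {c x y : ℝ} {k : ℕ} (hk : 0 < k)
    (h : ⌊c * k * x⌋ = ⌊c * k * y⌋) : ⌊c * x⌋ = ⌊c * y⌋ := by
  have hk' : (k : ℝ) ≠ 0 := by positivity
  have e (t : ℝ) : ⌊c * t⌋ = ⌊c * k * t⌋ / (k : ℤ) := by
    rw [← Int.floor_div_natCast]
    congr 1
    field_simp
  rw [e x, e y, h]

/-- Interval exchanges of the `I_j` respect the partition of each `I_j` into `k` equal parts. -/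
theorem floor_permMap_eq (N : ℕ) [NeZero N] (σ : Equiv.Perm (ZMod N)) {x y : Ico (0:ℝ) 1} {k : ℕ}
    (hk : 0 < k) (h : ⌊(N : ℝ) * k * x.val⌋ = ⌊(N : ℝ) * k * y.val⌋) :
    ⌊(N : ℝ) * k * (permMap N σ x).val⌋ = ⌊(N : ℝ) * k * (permMap N σ y).val⌋ := by
  have hc : cell N x = cell N y := by rw [cell, cell, floor_eq_of_floor_mul_eq hk h]
  have e (t : Ico (0:ℝ) 1) : (N : ℝ) * k * (permMap N σ t).val
      = N * k * t.val + ((k * ((σ (cell N t)).val - (cell N t).val) : ℤ) : ℝ) := by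
    rw [mul_right_comm, mul_permMap_val]
    push_cast
    ring
  rw [e x, e y, Int.floor_add_intCast, Int.floor_add_intCast, h, hc]

theorem cell_val_div (m : ℕ) [NeZero m] (z : Ico (0:ℝ) 1) :
    (((cell (2 * m) z).val / m : ℕ) : ℤ) = ⌊2 * z.val⌋ := by
  have hm : (m : ℝ) ≠ 0 := by exact_mod_cast NeZero.ne m
  push_cast
  rw [cell_val, ← Int.floor_div_natCast]
  congr 1
  push_cast
  field_simp

/-- The parity of the subinterval containing `x` is the half of `[0,1)` containing `m x mod 1`. -/
theorem cell_mulMap_div (m : ℕ) [NeZero m] (x : Ico (0:ℝ) 1) :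
    (cell (2 * m) (mulMap m x)).val / m = (cell (2 * m) x).val % 2 := by
  zify
  have h := cell_val_div m (mulMap m x)
  push_cast at h
  rw [h, cell_val]
  change ⌊2 * Int.fract (m * x.val)⌋ = _
  have e : (((2 * m : ℕ) : ℝ)) * x.val
      = 2 * Int.fract (m * x.val) + ((2 * ⌊m * x.val⌋ : ℤ) : ℝ) := by
    rw [Int.fract]
    push_cast
    ring
  have h0 := Int.fract_nonneg ((m : ℝ) * x.val)
  have h1 := Int.fract_lt_one ((m : ℝ) * x.val)
  have f0 : 0 ≤ ⌊2 * Int.fract ((m : ℝ) * x.val)⌋ := Int.floor_nonneg.2 (by linarith)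
  have f1 : ⌊2 * Int.fract ((m : ℝ) * x.val)⌋ < 2 := Int.floor_lt.2 (by push_cast; linarith)
  rw [e, Int.floor_add_intCast]
  omega

/-- The inverse branches of `x ↦ m x mod 1`. -/
theorem exists_mulMap_eq (m : ℕ) [NeZero m] (z : Ico (0:ℝ) 1) {q : ℤ} (h0 : 0 ≤ q) (hq : q < m) :
    ∃ x, mulMap m x = z ∧ (m : ℝ) * x.val = z.val + q := by
  have hm : (0 : ℝ) < m := by exact_mod_cast Nat.pos_of_ne_zero (NeZero.ne m)
  obtain ⟨z, hz0, hz1⟩ := z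
  have h0' : (0 : ℝ) ≤ q := by exact_mod_cast h0
  have hq' : (q : ℝ) + 1 ≤ m := by exact_mod_cast hq
  refine ⟨⟨(z + q) / m, by positivity, by rw [div_lt_one hm]; linarith⟩, ?_, by field_simp⟩
  apply Subtype.ext
  change Int.fract ((m : ℝ) * ((z + q) / m)) = z
  rw [mul_div_cancel₀ _ hm.ne', Int.fract_add_intCast, Int.fract_eq_self]
  exact ⟨hz0, hz1⟩

theorem exists_permMap_mulMap_eq (m : ℕ) [NeZero m] (σ : Equiv.Perm (ZMod (2 * m)))
    (y : Ico (0:ℝ) 1) (c : ZMod (2 * m)) (h : (σ⁻¹ (cell (2 * m) y)).val / m = c.val % 2) :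
    ∃ x, permMap (2 * m) σ (mulMap m x) = y ∧ cell (2 * m) x = c := by
  have hc := ZMod.val_lt c
  obtain ⟨x, hx, hx'⟩ := exists_mulMap_eq m (permMap (2 * m) σ⁻¹ y)
    (q := (c.val / 2 : ℕ)) (by positivity) (by omega)
  refine ⟨x, by rw [hx, permMap_permMap_inv], ZMod.val_injective _ ?_⟩
  have hd := cell_val_div m (permMap (2 * m) σ⁻¹ y)
  rw [cell_permMap, h] at hd
  have e : (((2 * m : ℕ) : ℝ)) * x.val
      = 2 * (permMap (2 * m) σ⁻¹ y).val + ((2 * (c.val / 2 : ℕ) : ℤ) : ℝ) := by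
    push_cast at hx' ⊢
    linarith
  have := cell_val (2 * m) x
  rw [e, Int.floor_add_intCast, ← hd] at this
  omega

theorem exists_lift (m : ℕ) [NeZero m] (σ : Equiv.Perm (ZMod (2 * m))) (x w : Ico (0:ℝ) 1) {k : ℕ}
    (hk : 0 < k) (h : ⌊((2 * m : ℕ) : ℝ) * k * w.val⌋
      = ⌊((2 * m : ℕ) : ℝ) * k * (permMap (2 * m) σ (mulMap m x)).val⌋) :
    ∃ x', permMap (2 * m) σ (mulMap m x') = w ∧
      ⌊((2 * m : ℕ) : ℝ) * (k * m : ℕ) * x'.val⌋ = ⌊((2 * m : ℕ) : ℝ) * (k * m : ℕ) * x.val⌋ := by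
  have hm : (0 : ℝ) < m := by exact_mod_cast Nat.pos_of_ne_zero (NeZero.ne m)
  have hx0 := x.2.1
  have hx1 := x.2.2
  obtain ⟨x', hx', hx''⟩ := exists_mulMap_eq m (permMap (2 * m) σ⁻¹ w) (q := ⌊(m : ℝ) * x.val⌋)
    (Int.floor_nonneg.2 (by positivity)) (Int.floor_lt.2 (by push_cast; nlinarith))
  refine ⟨x', by rw [hx', permMap_permMap_inv], ?_⟩
  have hfl := floor_permMap_eq (2 * m) σ⁻¹ hk h
  rw [permMap_inv_permMap] at hfl
  have e : ((2 * m : ℕ) : ℝ) * (k * m : ℕ) * x'.val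
      = ((2 * m : ℕ) : ℝ) * k * (permMap (2 * m) σ⁻¹ w).val
        + ((2 * m * k * ⌊(m : ℝ) * x.val⌋ : ℤ) : ℝ) := by
    push_cast
    linear_combination (2 * m * k : ℝ) * hx''
  have e' : ((2 * m : ℕ) : ℝ) * (k * m : ℕ) * x.val
      = ((2 * m : ℕ) : ℝ) * k * (mulMap m x).val
        + ((2 * m * k * ⌊(m : ℝ) * x.val⌋ : ℤ) : ℝ) := by
    change _ = _ * Int.fract ((m : ℝ) * x.val) + _
    rw [Int.fract]
    push_cast
    ring
  rw [e, e', Int.floor_add_intCast, Int.floor_add_intCast, hfl]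

/-- If `σ` sends some index of each half to each parity class, then the points reaching `y` after
`n + 2` steps meet every interval of the `n`-th refinement of the partition. -/
theorem exists_iterate_eq (m : ℕ) [NeZero m] (σ : Equiv.Perm (ZMod (2 * m)))
    (hσ : ∀ p < 2, ∀ b < 2, ∃ c : ZMod (2 * m), c.val / m = p ∧ (σ c).val % 2 = b)
    (n : ℕ) (x y : Ico (0:ℝ) 1) :
    ∃ x', (fun x => permMap (2 * m) σ (mulMap m x))^[n + 2] x' = y ∧
      ⌊((2 * m : ℕ) : ℝ) * (m ^ n : ℕ) * x'.val⌋ = ⌊((2 * m : ℕ) : ℝ) * (m ^ n : ℕ) * x.val⌋ := by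
  have hm := Nat.pos_of_ne_zero (NeZero.ne m)
  induction n generalizing x with
  | zero =>
    have hlt := ZMod.val_lt (σ⁻¹ (cell (2 * m) y))
    obtain ⟨c, hc, hc'⟩ := hσ ((cell (2 * m) x).val % 2) (Nat.mod_lt _ two_pos)
      ((σ⁻¹ (cell (2 * m) y)).val / m) ((Nat.div_lt_iff_lt_mul hm).2 hlt)
    obtain ⟨u, hu, hu'⟩ := exists_permMap_mulMap_eq m σ y (σ c) hc'.symm
    obtain ⟨x', hx, hx'⟩ := exists_permMap_mulMap_eq m σ u (cell (2 * m) x) (by simp [hu', hc])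
    refine ⟨x', ?_, ?_⟩
    · simp [hx, hu]
    · rw [pow_zero, Nat.cast_one, mul_one, ← cell_val, ← cell_val, hx']
  | succ n ih =>
    obtain ⟨w, hw, hw'⟩ := ih (permMap (2 * m) σ (mulMap m x))
    obtain ⟨x', hx, hx'⟩ := exists_lift m σ x w (pow_pos hm n) hw'
    refine ⟨x', ?_, hx'⟩
    rw [show n + 1 + 2 = (n + 2) + 1 from rfl, Function.iterate_succ_apply, hx, hw]

theorem topMixing_of_exists (m : ℕ) (hm : 2 ≤ m) (σ : Equiv.Perm (ZMod (2 * m)))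
    (hσ : ∀ p < 2, ∀ b < 2, ∃ c : ZMod (2 * m), c.val / m = p ∧ (σ c).val % 2 = b) :
    TopMixing (fun x => permMap (2 * m) σ (mulMap m x)) := by
  have : NeZero m := ⟨by omega⟩
  rintro U V hU - ⟨x, hx⟩ ⟨y, hy⟩
  obtain ⟨ε, hε, hball⟩ := Metric.isOpen_iff.1 hU x hx
  obtain ⟨n₀, hn₀⟩ := exists_nat_gt (1 / ε)
  refine ⟨n₀ + 2, fun n hn => ?_⟩
  obtain ⟨k, rfl⟩ := Nat.exists_eq_add_of_le' (le_of_add_le_right hn)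
  obtain ⟨x', hx', hfl⟩ := exists_iterate_eq m σ hσ k x y
  refine ⟨y, ⟨x', hball ?_, hx'⟩, hy⟩
  have hlt := Int.abs_sub_lt_one_of_floor_eq_floor hfl
  rw [← mul_sub, abs_mul] at hlt
  rw [Metric.mem_ball, Subtype.dist_eq, Real.dist_eq]
  have hk : n₀ ≤ 2 * m * m ^ k := by
    have := (Nat.lt_pow_self (n := k) (by omega : 1 < m)).le
    nlinarith
  have hk' : (n₀ : ℝ) ≤ |((2 * m : ℕ) : ℝ) * (m ^ k : ℕ)| := by
    rw [abs_of_nonneg (by positivity)]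
    exact_mod_cast hk
  rw [div_lt_iff₀ hε] at hn₀
  by_contra! hle
  nlinarith [abs_nonneg (x'.val - x.val)]

theorem not_topMixing_of_parity (m : ℕ) (hm : 2 ≤ m) (σ : Equiv.Perm (ZMod (2 * m))) (e : ℕ)
    (hσ : ∀ c : ZMod (2 * m), (σ c).val % 2 = (c.val / m + e) % 2) :
    ¬ TopMixing (fun x => permMap (2 * m) σ (mulMap m x)) := by
  have : NeZero m := ⟨by omega⟩
  have hm' : (2 : ℝ) ≤ m := by exact_mod_cast hm
  intro h
  have hstep (x : Ico (0:ℝ) 1) : (cell (2 * m) (permMap (2 * m) σ (mulMap m x))).val % 2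
      = ((cell (2 * m) x).val + e) % 2 := by
    rw [cell_permMap, hσ, cell_mulMap_div]
    omega
  have hiter (n : ℕ) (x : Ico (0:ℝ) 1) :
      (cell (2 * m) ((fun x => permMap (2 * m) σ (mulMap m x))^[n] x)).val % 2
      = ((cell (2 * m) x).val + n * e) % 2 := by
    induction n with
    | zero => simp
    | succ n ih =>
      rw [Function.iterate_succ_apply', hstep, add_mul]
      omega
  have hcell (x : Ico (0:ℝ) 1) (k : ℕ) (h0 : k ≤ ((2 * m : ℕ) : ℝ) * x.val)
      (h1 : ((2 * m : ℕ) : ℝ) * x.val < k + 1) : (cell (2 * m) x).val = k := by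
    have h2 := cell_val (2 * m) x
    have h3 : ⌊((2 * m : ℕ) : ℝ) * x.val⌋ = k :=
      Int.floor_eq_iff.2 ⟨by simpa using h0, by simpa using h1⟩
    omega
  obtain ⟨n₀, hn⟩ := h {x | ((2 * m : ℕ) : ℝ) * x.val < 1}
    {x | 1 < ((2 * m : ℕ) : ℝ) * x.val ∧ ((2 * m : ℕ) : ℝ) * x.val < 2}
    (isOpen_lt (by fun_prop) (by fun_prop))
    (IsOpen.and (isOpen_lt (by fun_prop) (by fun_prop)) (isOpen_lt (by fun_prop) (by fun_prop)))
    ⟨⟨0, by simp⟩, by simp⟩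
    ⟨⟨3 / 2 / (2 * m), by positivity, by rw [div_lt_one] <;> linarith⟩, by
      have : (m : ℝ) ≠ 0 := by positivity
      constructor <;> push_cast <;> field_simp <;> norm_num⟩
  obtain ⟨_, ⟨x, hx, rfl⟩, h1, h2⟩ := hn (2 * n₀) (by omega)
  have hi := hiter (2 * n₀) x
  have hx0 := x.2.1
  rw [hcell x 0 (by push_cast; positivity) (by simpa using hx),
    hcell _ 1 (by simpa using h1.le) (by norm_num; simpa using h2)] at hi
  rw [mul_assoc] at hi
  omega

theorem ZMod.card_filter_val (N : ℕ) [NeZero N] (p : ℕ → Prop) [DecidablePred p] :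
    Fintype.card {c : ZMod N // p c.val} = N.count p := by
  rw [Fintype.card_subtype, Nat.count_eq_card_filter_range]
  refine Finset.card_nbij' (fun c => c.val) (fun k => (k : ZMod N)) ?_ ?_ ?_ ?_
  · intro c hc
    simpa [ZMod.val_lt] using hc
  · intro k hk
    simp only [Finset.coe_filter, Finset.mem_range, Set.mem_ofPred_eq] at hk
    simpa [ZMod.val_cast_of_lt hk.1] using hk.2
  · intro c _
    simp
  · intro k hk
    simp only [Finset.coe_filter, Finset.mem_range, Set.mem_ofPred_eq] at hk
    exact ZMod.val_cast_of_lt hk.1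

theorem card_parity (m : ℕ) [NeZero m] {b : ℕ} (hb : b < 2) :
    Fintype.card {c : ZMod (2 * m) // c.val % 2 = b} = m := by
  rw [ZMod.card_filter_val (2 * m) (fun k => k % 2 = b)]
  generalize m = n
  induction n with
  | zero => simp
  | succ n ih =>
    rw [mul_add, mul_one, Nat.count_succ, Nat.count_succ, ih]
    split_ifs <;> omega

theorem card_half (m : ℕ) [NeZero m] {p : ℕ} (hp : p < 2) :
    Fintype.card {c : ZMod (2 * m) // c.val / m = p} = m := by
  have hm := Nat.pos_of_ne_zero (NeZero.ne m)
  rw [ZMod.card_filter_val (2 * m) (fun k => k / m = p), two_mul, Nat.count_add]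
  have h0 (q : ℕ) : ∀ k < m, ((m * q + k) / m = p ↔ q = p) := by
    intro k hk
    rw [Nat.mul_add_div hm, Nat.div_eq_of_lt hk, add_zero]
  have h1 (q : ℕ) : Nat.count (fun k => (m * q + k) / m = p) m = if q = p then m else 0 := by
    rw [Nat.count_eq_card_filter_range,
      Finset.filter_congr (fun k hk => h0 q k (Finset.mem_range.1 hk))]
    split_ifs <;> simp [*]
  have h2 := h1 0
  have h3 := h1 1
  simp only [mul_zero, zero_add, mul_one] at h2 h3
  rw [h2, h3]
  interval_cases p <;> simp

/-- The permutations carrying one labelling to another with equinumerous fibres are as many as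
those preserving the second. -/
theorem card_perm_comp_eq {α ι : Type*} [Fintype α] [DecidableEq α] [Fintype ι] [DecidableEq ι]
    (p q : α → ι) (h : ∀ i, Fintype.card {a // p a = i} = Fintype.card {a // q a = i}) :
    Fintype.card {σ : Equiv.Perm α // q ∘ σ = p}
      = ∏ i, (Fintype.card {a // q a = i}).factorial := by
  rw [← DomMulAct.stabilizer_card q]
  let τ : Equiv.Perm α := Equiv.ofFiberEquiv fun i => Fintype.equivOfCardEq (h i)
  have hτ : q ∘ τ = p := funext fun a => Equiv.ofFiberEquiv_map _ a
  refine Fintype.card_congr ((Equiv.mulRight τ⁻¹).subtypeEquiv fun σ => ?_)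
  rw [← hτ, Equiv.coe_mulRight, Equiv.Perm.coe_mul, ← Function.comp_assoc,
    Equiv.Perm.inv_def, Equiv.comp_symm_eq]

theorem half_lt_two {m : ℕ} [NeZero m] (c : ZMod (2 * m)) : c.val / m < 2 :=
  (Nat.div_lt_iff_lt_mul (Nat.pos_of_ne_zero (NeZero.ne m))).2 (ZMod.val_lt c)

theorem ncard_parity (m : ℕ) [NeZero m] (e : ℕ) :
    {σ : Equiv.Perm (ZMod (2 * m)) | ∀ c, (σ c).val % 2 = (c.val / m + e) % 2}.ncard
      = m.factorial ^ 2 := by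
  have hq (i : Fin 2) : Fintype.card {c : ZMod (2 * m) // Fin.ofNat 2 c.val = i} = m := by
    refine .trans ?_ (card_parity m i.2)
    exact Fintype.card_congr (Equiv.subtypeEquivRight fun c => Fin.ext_iff)
  have hp (i : Fin 2) :
      Fintype.card {c : ZMod (2 * m) // Fin.ofNat 2 (c.val / m + e) = i} = m := by
    conv_rhs => rw [← card_half m (Nat.mod_lt (i + e) two_pos)]
    refine Fintype.card_congr (Equiv.subtypeEquivRight fun c => ?_)
    rw [Fin.ext_iff, Fin.val_ofNat]
    rcases Nat.le_one_iff_eq_zero_or_eq_one.1 (Nat.le_of_lt_succ (half_lt_two c)) with hc | hc <;>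
      rw [hc] <;> omega
  have h := card_perm_comp_eq (fun c : ZMod (2 * m) => Fin.ofNat 2 (c.val / m + e))
    (fun c => Fin.ofNat 2 c.val) fun i => (hp i).trans (hq i).symm
  simp only [hq, Finset.prod_const, Finset.card_univ, Fintype.card_fin] at h
  rw [← h, ← Nat.card_coe_set_eq, ← Nat.card_eq_fintype_card]
  refine Nat.card_congr (Equiv.subtypeEquivRight fun σ => ?_)
  simp [funext_iff, Fin.ext_iff]

/-- A permutation sending no index of some half to some parity class matches halves with parity
classes. -/
theorem exists_parity_of_forall_ne (m : ℕ) [NeZero m] (σ : Equiv.Perm (ZMod (2 * m))) {p b : ℕ}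
    (hp : p < 2) (hb : b < 2) (h : ∀ c : ZMod (2 * m), c.val / m = p → (σ c).val % 2 ≠ b)
    (c : ZMod (2 * m)) : (σ c).val % 2 = (c.val / m + (p + b + 1) % 2) % 2 := by
  have hsub : ({c : ZMod (2 * m) | c.val / m = p} : Finset _).map σ.toEmbedding
      ⊆ ({c : ZMod (2 * m) | c.val % 2 = 1 - b} : Finset _) := by
    intro d hd
    simp only [Finset.mem_map, Finset.mem_filter, Finset.mem_univ, true_and] at hd ⊢
    obtain ⟨c, hc, rfl⟩ := hd
    have := h c hc
    simp only [Equiv.coe_toEmbedding]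
    omega
  have heq := Finset.eq_of_subset_of_card_le hsub (by
    rw [Finset.card_map, ← Fintype.card_subtype, ← Fintype.card_subtype, card_half m hp,
      card_parity m (by omega)])
  have hiff : (σ c).val % 2 = 1 - b ↔ c.val / m = p := by
    simpa using (Finset.ext_iff.1 heq (σ c)).symm
  rcases Nat.le_one_iff_eq_zero_or_eq_one.1 (Nat.le_of_lt_succ (half_lt_two c)) with hc | hc <;>
    rw [hc] at hiff ⊢ <;> interval_cases p <;> omega

theorem setOf_not_topMixing (m : ℕ) (hm : 2 ≤ m) :
    {σ : Equiv.Perm (ZMod (2 * m)) |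
        ¬ TopMixing (fun x => permMap (2 * m) σ (mulMap m x))}
      = {σ | ∀ c, (σ c).val % 2 = (c.val / m + 0) % 2}
        ∪ {σ | ∀ c, (σ c).val % 2 = (c.val / m + 1) % 2} := by
  have : NeZero m := ⟨by omega⟩
  ext σ
  constructor
  · intro h
    have h' := mt (topMixing_of_exists m hm σ) h
    push Not at h'
    obtain ⟨p, hp, b, hb, hne⟩ := h'
    have hpar := exists_parity_of_forall_ne m σ hp hb hne
    rcases Nat.mod_two_eq_zero_or_one (p + b + 1) with he | he <;> rw [he] at hpar
    · exact Or.inl hpar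
    · exact Or.inr hpar
  · rintro (h | h)
    · exact not_topMixing_of_parity m hm σ 0 h
    · exact not_topMixing_of_parity m hm σ 1 h

theorem ncard_not_topMixing (m : ℕ) (hm : 2 ≤ m) :
    {σ : Equiv.Perm (ZMod (2 * m)) |
        ¬ TopMixing (fun x => permMap (2 * m) σ (mulMap m x))}.ncard
      = 2 * m.factorial ^ 2 := by
  have : NeZero m := ⟨by omega⟩
  rw [setOf_not_topMixing m hm, Set.ncard_union_eq, ncard_parity, ncard_parity, two_mul]
  rw [Set.disjoint_left]
  intro σ h0 h1
  have h0' := h0 0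
  have h1' := h1 0
  omega

/-- for `N = 2m`, exactly `2·(m!)²` permutations give a non-mixing
composition; equivalently the proportion is `1 / C(2m−1, m)`. -/
theorem stmt8 (m : ℕ) (hm : 2 ≤ m) :
    {σ : Equiv.Perm (ZMod (2 * m)) |
        ¬ TopMixing (fun x => permMap (2 * m) σ (mulMap m x))}.ncard
      = 2 * m.factorial ^ 2 ∧
    ({σ : Equiv.Perm (ZMod (2 * m)) |
        ¬ TopMixing (fun x => permMap (2 * m) σ (mulMap m x))}.ncard : ℝ)
        / ((2 * m).factorial : ℝ)
      = (((2 * m - 1).choose m : ℝ))⁻¹ := by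
  refine ⟨ncard_not_topMixing m hm, ?_⟩
  rw [ncard_not_topMixing m hm]
  obtain ⟨k, rfl⟩ : ∃ k, m = k + 1 := ⟨m - 1, by omega⟩
  have h := Nat.add_choose_mul_factorial_mul_factorial k (k + 1)
  have hk : 2 * (k + 1) - 1 = k + (k + 1) := by omega
  have hc : 0 < (k + (k + 1)).choose (k + 1) := Nat.choose_pos (by omega)
  have hfac : (2 * (k + 1)).factorial
      = 2 * (k + 1).factorial ^ 2 * (k + (k + 1)).choose (k + 1) := by
    rw [show 2 * (k + 1) = (k + (k + 1)) + 1 by ring, Nat.factorial_succ, ← h,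
      ← Nat.choose_symm_add, Nat.factorial_succ k]
    ring
  have hf := Nat.factorial_pos (k + 1)
  rw [hk, hfac]
  push_cast
  field_simp
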